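/- Let ξ be a fixed stack array and let η, η₀ be configurations with η₀ ≥ η pointwise. Then: (i) any site x that is unstable in η is unstable in η₀; and (ii) any toppling sequence α that is legal for η is also legal for η₀, and Φ_α(η₀) ≥ Φ_α(η) pointwise. -/

import Mathlib

/-!
Activated Random Walk: configurations, stacks, toppling, Abelian property.

Configurations are elements of `Ω = (ℕ ∪ {ρ})^ℤ`; `num n` means `n` active particles,
`rho` a single sleeping particle.  A stack array assigns to each site `x` and each
index `j` an instruction `τ_{x,x-1}`, `τ_{x,x+1}` or `τ_{x,ρ}` (encoded as
`left`, `right`, `sleep`).  Toppling at `x` uses the first unused instruction of the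
stack at `x` (indices start at `0`, i.e. the `(h x + 1)`-st instruction).
-/

/-- The state of a single site: `num n` = `n` active particles, `rho` = one sleeping
particle. -/
inductive ARWState where
  | num : ℕ → ARWState
  | rho : ARWState
deriving DecidableEq

/-- Configurations on `ℤ`. -/
abbrev Config := ℤ → ARWState

/-- Adding one (active) particle to a site: `ρ + 1 = 2`. -/
def ARWState.inc : ARWState → ARWState
  | .num n => .num (n + 1)
  | .rho => .num 2

/-- Removing one active particle from a site (only meaningful at unstable sites). -/
def ARWState.dec : ARWState → ARWState
  | .num (n + 1) => .num n
  | s => s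

/-- The effect of a sleep instruction `τ_{x,ρ}`: `ρ·1 = ρ`, `ρ·n = n` for `n > 1`. -/
def ARWState.toSleep : ARWState → ARWState
  | .num 1 => .rho
  | s => s

/-- A site `x` is unstable in `η` if it carries at least one active particle. -/
def Unstable (η : Config) (x : ℤ) : Prop := ∃ n : ℕ, 1 ≤ n ∧ η x = .num n

/-- The three kinds of instructions at a site `x`: `τ_{x,x-1}`, `τ_{x,x+1}`, `τ_{x,ρ}`. -/
inductive Instr where
  | left : Instr
  | right : Instr
  | sleep : Instr
deriving DecidableEq

/-- The action of an instruction at site `x` on a configuration. -/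
def applyInstr (ι : Instr) (x : ℤ) (η : Config) : Config :=
  match ι with
  | .left => fun z => if z = x then (η x).dec else if z = x - 1 then (η (x - 1)).inc else η z
  | .right => fun z => if z = x then (η x).dec else if z = x + 1 then (η (x + 1)).inc else η z
  | .sleep => fun z => if z = x then (η x).toSleep else η z

/-- A stack array `ξ = (ξ_{(x,j)})`. -/
abbrev Stacks := ℤ → ℕ → Instr

/-- One toppling at `x`, acting on a pair (configuration, odometer): it uses the first
unused instruction `ξ_{(x, h x + 1)}` of the stack at `x` and increases the odometer
at `x` by one. -/
def toppleOne (ξ : Stacks) (x : ℤ) (p : Config × (ℤ → ℕ)) : Config × (ℤ → ℕ) :=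
  (applyInstr (ξ x (p.2 x)) x p.1, Function.update p.2 x (p.2 x + 1))

/-- Toppling along a finite sequence `α = (x₁, …, x_k)`, i.e. `Φ_α = Φ_{x_k} ∘ ⋯ ∘ Φ_{x_1}`. -/
def toppleSeq (ξ : Stacks) : List ℤ → Config × (ℤ → ℕ) → Config × (ℤ → ℕ)
  | [], p => p
  | x :: α, p => toppleSeq ξ α (toppleOne ξ x p)

/-- Legality of a toppling sequence: each successive toppling happens at a site that is
unstable in the configuration at that stage. -/
def LegalFrom (ξ : Stacks) : List ℤ → Config × (ℤ → ℕ) → Prop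
  | [], _ => True
  | x :: α, p => Unstable p.1 x ∧ LegalFrom ξ α (toppleOne ξ x p)

/-- `Φ_α(η)`: the configuration resulting from toppling the sequence `α` starting from `η`
(and odometer `0`). -/
def topple (ξ : Stacks) (α : List ℤ) (η : Config) : Config :=
  (toppleSeq ξ α (η, fun _ => 0)).1

/-- `α` is a legal toppling sequence for `η` (with fresh stacks). -/
def LegalSeq (ξ : Stacks) (α : List ℤ) (η : Config) : Prop :=
  LegalFrom ξ α (η, fun _ => 0)

/-- The linear order `0 < ρ < 1 < 2 < ⋯` on `ℕ ∪ {ρ}`, realized by the embedding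
`num n ↦ n`, `ρ ↦ 1/2` into `ℚ`. -/
def ARWState.val : ARWState → ℚ
  | .num n => n
  | .rho => 1 / 2

/-- Pointwise order on configurations (with `0 < ρ < 1 < 2 < ⋯` at each site). -/
def ConfigLE (η η' : Config) : Prop := ∀ x : ℤ, (η x).val ≤ (η' x).val

/-- Integer version of the order. -/
def ARWState.code : ARWState → ℕ
  | .num n => 2 * n
  | .rho => 1

theorem val_eq_code (s : ARWState) : s.val = (s.code : ℚ) / 2 := by
  cases s <;> simp [ARWState.val, ARWState.code]

theorem val_le_iff (s t : ARWState) : s.val ≤ t.val ↔ s.code ≤ t.code := by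
  rw [val_eq_code, val_eq_code, div_le_div_iff_of_pos_right (by norm_num)]
  exact Nat.cast_le

theorem inc_mono (s t : ARWState) (h : s.val ≤ t.val) : s.inc.val ≤ t.inc.val := by
  rw [val_le_iff] at *
  cases s <;> cases t <;> simp only [ARWState.inc, ARWState.code] at * <;> omega

theorem unstable_mono {η η₀ : Config} (hle : ConfigLE η η₀) (x : ℤ) (h : Unstable η x) :
    Unstable η₀ x := by
  obtain ⟨n, hn, hx⟩ := h
  have h1 := hle x
  rw [val_le_iff, hx] at h1
  cases h2 : η₀ x with
  | num m =>
    rw [h2] at h1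
    simp only [ARWState.code] at h1
    exact ⟨m, by omega, h2⟩
  | rho =>
    rw [h2] at h1
    simp only [ARWState.code] at h1
    omega

theorem applyInstr_mono (ι : Instr) {η η₀ : Config} (hle : ConfigLE η η₀) (x : ℤ)
    (h : Unstable η x) : ConfigLE (applyInstr ι x η) (applyInstr ι x η₀) := by
  obtain ⟨m, hm, hx0⟩ := unstable_mono hle x h
  obtain ⟨n, hn, hx⟩ := h
  have h1 := hle x
  rw [val_le_iff, hx, hx0] at h1
  simp only [ARWState.code] at h1
  obtain ⟨n, rfl⟩ := Nat.exists_eq_add_of_le' hn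
  obtain ⟨m, rfl⟩ := Nat.exists_eq_add_of_le' hm
  have hdec : (η x).dec.val ≤ (η₀ x).dec.val := by
    rw [hx, hx0, val_le_iff]
    simp only [ARWState.dec, ARWState.code]
    omega
  have hsl : (η x).toSleep.val ≤ (η₀ x).toSleep.val := by
    rw [hx, hx0, val_le_iff]
    rcases n with _ | n <;> rcases m with _ | m <;>
      simp [ARWState.toSleep, ARWState.code] at * <;> omega
  intro z
  cases ι <;> simp only [applyInstr] <;> split_ifs <;>
    first | exact hdec | exact hsl | exact inc_mono _ _ (hle _) | exact hle _

theorem legalFrom_mono (ξ : Stacks) (α : List ℤ) : ∀ (η η₀ : Config) (h : ℤ → ℕ),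
    ConfigLE η η₀ → LegalFrom ξ α (η, h) →
    LegalFrom ξ α (η₀, h) ∧
      ConfigLE (toppleSeq ξ α (η, h)).1 (toppleSeq ξ α (η₀, h)).1 := by
  induction α with
  | nil => intro η η₀ h hle _; exact ⟨trivial, hle⟩
  | cons x α ih =>
    intro η η₀ h hle hl
    have := ih _ _ _ (applyInstr_mono (ξ x (h x)) hle x hl.1) hl.2
    exact ⟨⟨unstable_mono hle x hl.1, this.1⟩, this.2⟩

/-- **Monotonicity in the initial configuration.**  If `η₀ ≥ η` pointwise, then every site
unstable in `η` is unstable in `η₀`; moreover any toppling sequence legal for `η` is legal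
for `η₀`, and `Φ_α(η₀) ≥ Φ_α(η)` pointwise. -/
theorem topple_monotone (ξ : Stacks) (η η₀ : Config) (hle : ConfigLE η η₀) :
    (∀ x : ℤ, Unstable η x → Unstable η₀ x) ∧
    (∀ α : List ℤ, LegalSeq ξ α η →
      LegalSeq ξ α η₀ ∧ ConfigLE (topple ξ α η) (topple ξ α η₀)) := by
  exact ⟨unstable_mono hle, fun α hα => legalFrom_mono ξ α η η₀ _ hle hα⟩
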